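/- Fix 0 < q < 1 and γ > 0, and define f_λ(x;μ) = d(x;μ) − I(μ) − λ(x² − γ). A measure μ₀ ∈ Λ(γ,q) maximizes I(μ) over Λ(γ,q) if and only if there exists λ ≥ 0 such that λ·(∫ x² dμ₀(x) − γ) = 0 and ∫ f_λ(x;μ₀) dμ(x) ≤ 0 for every Borel probability measure μ on ℝ with μ({0}) ≥ q and finite second moment. -/

import Mathlib

open MeasureTheory Real Filter

/-- The standard Gaussian density `φ(t) = (2π)^{-1/2} e^{-t²/2}`. -/
noncomputable def gauss (t : ℝ) : ℝ := Real.exp (-t ^ 2 / 2) / Real.sqrt (2 * Real.pi)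

/-- The output density `p_Y(y;μ) = ∫ φ(y−x) dμ(x)`. -/
noncomputable def outDen (μ : Measure ℝ) (y : ℝ) : ℝ := ∫ x, gauss (y - x) ∂μ

/-- The relative entropy `d(x;μ) = ∫ φ(y−x) log(φ(y−x)/p_Y(y;μ)) dy`. -/
noncomputable def relEnt (x : ℝ) (μ : Measure ℝ) : ℝ :=
  ∫ y, gauss (y - x) * Real.log (gauss (y - x) / outDen μ y)

/-- The mutual information `I(μ) = ∫ d(x;μ) dμ(x)`. -/
noncomputable def mutInfo (μ : Measure ℝ) : ℝ := ∫ x, relEnt x μ ∂μ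

/-- The constraint set `Λ(γ,q)`: probability measures with `μ({0}) ≥ q` and second moment
at most `γ`. -/
def memLam (γ q : ℝ) (μ : Measure ℝ) : Prop :=
  IsProbabilityMeasure μ ∧ ENNReal.ofReal q ≤ μ {0} ∧
    ∫⁻ x, ENNReal.ofReal (x ^ 2) ∂μ ≤ ENNReal.ofReal γ

/-- The function `f_λ(x;μ) = d(x;μ) − I(μ) − λ(x² − γ)`. -/
noncomputable def fCost (γ lam x : ℝ) (μ : Measure ℝ) : ℝ :=
  relEnt x μ - mutInfo μ - lam * (x ^ 2 - γ)

lemma gauss_pos (t : ℝ) : 0 < gauss t := by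
  unfold gauss; positivity

lemma gauss_cont : Continuous gauss := by
  unfold gauss; fun_prop

lemma gauss_le_one (t : ℝ) : gauss t ≤ 1 := by
  unfold gauss
  have h1 : (1:ℝ) ≤ Real.sqrt (2 * Real.pi) := by
    rw [Real.one_le_sqrt]
    nlinarith [Real.pi_gt_three]
  have h2 : Real.exp (-t ^ 2 / 2) ≤ 1 := by
    rw [Real.exp_le_one_iff]; nlinarith [sq_nonneg t]
  rw [div_le_one (by linarith)]
  linarith

lemma log_gauss (t : ℝ) : Real.log (gauss t) = -t ^ 2 / 2 - Real.log (Real.sqrt (2 * Real.pi)) := by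
  unfold gauss
  rw [Real.log_div (Real.exp_pos _).ne' (by positivity), Real.log_exp]

lemma gauss_int : Integrable gauss := by
  have := (integrable_exp_neg_mul_sq (b := 1/2) (by norm_num)).div_const (Real.sqrt (2 * Real.pi))
  refine this.congr (Eventually.of_forall fun t => ?_)
  simp only [gauss]; congr 2; ring

lemma gauss_integral : ∫ t, gauss t = 1 := by
  have : (fun t => gauss t) = fun t => Real.exp (-(1/2) * t ^ 2) / Real.sqrt (2 * Real.pi) := by
    funext t; simp only [gauss]; congr 2; ring
  rw [this, integral_div, integral_gaussian]
  rw [show Real.pi / (1/2) = 2 * Real.pi by ring]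
  exact div_self (by positivity)

lemma gauss_sq_int : Integrable (fun t => gauss t * t ^ 2) := by
  have := (integrable_rpow_mul_exp_neg_mul_sq (b := 1/2) (by norm_num) (s := 2)
    (by norm_num)).div_const (Real.sqrt (2 * Real.pi))
  refine this.congr (Eventually.of_forall fun t => ?_)
  simp only [gauss, Real.rpow_two]
  rw [show -(1/2) * t ^ 2 = -t^2/2 by ring]; ring

/-- probability, atom and second moment. -/
structure Good (q : ℝ) (μ : Measure ℝ) : Prop where
  prob : IsProbabilityMeasure μ
  atom : ENNReal.ofReal q ≤ μ {0}
  sq : Integrable (fun x : ℝ => x ^ 2) μ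

lemma sq_int_iff (μ : Measure ℝ) (h : (∫⁻ x, ENNReal.ofReal (x ^ 2) ∂μ) < ⊤) :
    Integrable (fun x : ℝ => x ^ 2) μ := by
  refine ⟨by fun_prop, ?_⟩
  rw [hasFiniteIntegral_iff_ofReal (Eventually.of_forall fun x => sq_nonneg x)]
  exact h

lemma Good.lint {q : ℝ} {μ : Measure ℝ} (h : Good q μ) :
    ∫⁻ x, ENNReal.ofReal (x ^ 2) ∂μ = ENNReal.ofReal (∫ x, x ^ 2 ∂μ) :=
  (ofReal_integral_eq_lintegral_ofReal h.sq (Eventually.of_forall fun x => sq_nonneg x)).symm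

lemma key_int {q : ℝ} {μ : Measure ℝ} (h : Good q μ) (u : ℝ × ℝ → ℝ) (hu : Measurable u)
    (C : ℝ) (hC : ∀ x y, |u (x, y)| ≤ C * (1 + x ^ 2 + y ^ 2)) :
    Integrable (fun p : ℝ × ℝ => gauss (p.2 - p.1) * u p) (μ.prod volume) := by
  have := h.prob
  have hC0 : 0 ≤ C := by
    have := (abs_nonneg _).trans (hC 0 0); simpa using this
  have hm : Measurable fun p : ℝ × ℝ => gauss (p.2 - p.1) :=
    gauss_cont.measurable.comp (by fun_prop)
  have hG : Integrable (fun p : ℝ × ℝ => gauss (p.2 - p.1) *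
      (C * (1 + 3 * p.1 ^ 2 + 2 * (p.2 - p.1) ^ 2))) (μ.prod volume) := by
    have hi : ∀ x, Integrable (fun y => gauss (y - x) * (C * (1 + 3 * x ^ 2 + 2 * (y - x) ^ 2))) := by
      intro x
      have h1 := (gauss_int.comp_sub_right x).mul_const (C * (1 + 3 * x ^ 2))
      have h2 := (gauss_sq_int.comp_sub_right x).mul_const (C * 2)
      refine (h1.add h2).congr (Eventually.of_forall fun y => ?_)
      simp only [Pi.add_apply]; ring
    have hmm : Measurable fun p : ℝ × ℝ => gauss (p.2 - p.1) *
        (C * (1 + 3 * p.1 ^ 2 + 2 * (p.2 - p.1) ^ 2)) := hm.mul (by fun_prop)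
    rw [integrable_prod_iff hmm.aestronglyMeasurable]
    refine ⟨Eventually.of_forall hi, ?_⟩
    have : (fun x => ∫ y, ‖gauss (y - x) * (C * (1 + 3 * x ^ 2 + 2 * (y - x) ^ 2))‖) =
        fun x => C * (1 + 3 * x ^ 2) + (∫ t, gauss t * t ^ 2) * (C * 2) := by
      funext x
      have e : ∀ y, ‖gauss (y - x) * (C * (1 + 3 * x ^ 2 + 2 * (y - x) ^ 2))‖ =
          gauss (y - x) * (C * (1 + 3 * x ^ 2)) + gauss (y - x) * (y - x) ^ 2 * (C * 2) := by
        intro y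
        have := (gauss_pos (y - x)).le
        rw [Real.norm_of_nonneg (by positivity)]; ring
      simp_rw [e]
      rw [integral_add ((gauss_int.comp_sub_right x).mul_const _)
        ((gauss_sq_int.comp_sub_right x).mul_const _), integral_mul_const, integral_mul_const,
        integral_sub_right_eq_self (fun t => gauss t),
        integral_sub_right_eq_self (fun t => gauss t * t ^ 2), gauss_integral, one_mul]
    simp only at this ⊢
    rw [this]
    exact (((integrable_const 1).add (h.sq.const_mul 3)).const_mul C).add (integrable_const _)
  refine hG.mono' (hm.mul hu).aestronglyMeasurable (Eventually.of_forall fun p => ?_)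
  rw [norm_mul, Real.norm_of_nonneg (gauss_pos _).le]
  refine mul_le_mul_of_nonneg_left ?_ (gauss_pos _).le
  refine (hC p.1 p.2).trans (mul_le_mul_of_nonneg_left ?_ hC0)
  nlinarith [sq_nonneg (p.2 - 2 * p.1)]

lemma gauss_shift_int {μ : Measure ℝ} [IsProbabilityMeasure μ] (y : ℝ) :
    Integrable (fun x => gauss (y - x)) μ := by
  refine Integrable.of_bound (C := 1) ?_ (Eventually.of_forall fun x => ?_)
  · exact (gauss_cont.comp (by fun_prop)).aestronglyMeasurable
  · rw [Real.norm_of_nonneg (gauss_pos _).le]; exact gauss_le_one _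

lemma outDen_meas (μ : Measure ℝ) [IsProbabilityMeasure μ] : Measurable (outDen μ) := by
  have hc : Continuous (Function.uncurry fun y x : ℝ => gauss (y - x)) :=
    gauss_cont.comp (by fun_prop)
  exact (hc.stronglyMeasurable.integral_prod_right (ν := μ)).measurable

lemma outDen_le {q : ℝ} {μ : Measure ℝ} (h : Good q μ) (y : ℝ) : outDen μ y ≤ 1 := by
  have := h.prob
  have := integral_mono (gauss_shift_int (μ := μ) y) (integrable_const 1)
    (fun x => gauss_le_one (y - x))
  simpa [outDen] using this

lemma le_outDen {q : ℝ} {μ : Measure ℝ} (h : Good q μ) (y : ℝ) :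
    q * gauss y ≤ outDen μ y := by
  have := h.prob
  have h1 : ∫ x in {0}, gauss (y - x) ∂μ ≤ outDen μ y :=
    setIntegral_le_integral (gauss_shift_int (μ := μ) y)
      (Eventually.of_forall fun x => (gauss_pos _).le)
  rw [integral_singleton] at h1
  have h2 : q ≤ μ.real {0} := by
    rw [Measure.real, ← ENNReal.ofReal_le_iff_le_toReal (measure_ne_top _ _)]; exact h.atom
  simp only [sub_zero, smul_eq_mul] at h1
  exact (mul_le_mul_of_nonneg_right h2 (gauss_pos y).le).trans h1

lemma outDen_pos {q : ℝ} (hq : 0 < q) {μ : Measure ℝ} (h : Good q μ) (y : ℝ) :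
    0 < outDen μ y := lt_of_lt_of_le (mul_pos hq (gauss_pos y)) (le_outDen h y)

lemma log_outDen_bound {q : ℝ} (hq : 0 < q) : ∃ K : ℝ, 0 ≤ K ∧ ∀ μ, Good q μ → ∀ y,
    |Real.log (outDen μ y)| ≤ K + y ^ 2 := by
  refine ⟨|Real.log q| + |Real.log (Real.sqrt (2 * Real.pi))|, by positivity, fun μ h y => ?_⟩
  have h1 : Real.log (outDen μ y) ≤ 0 := Real.log_nonpos (outDen_pos hq h y).le (outDen_le h y)
  have h2 := Real.log_le_log (mul_pos hq (gauss_pos y)) (le_outDen h y)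
  rw [Real.log_mul hq.ne' (gauss_pos y).ne', log_gauss] at h2
  rw [abs_of_nonpos h1]
  nlinarith [neg_abs_le (Real.log q), le_abs_self (Real.log (Real.sqrt (2 * Real.pi))), sq_nonneg y]

lemma F_int {q : ℝ} (hq : 0 < q) {μ ν : Measure ℝ} (h : Good q μ) (hν : Good q ν) :
    Integrable (fun p : ℝ × ℝ => gauss (p.2 - p.1) *
      Real.log (gauss (p.2 - p.1) / outDen ν p.2)) (μ.prod volume) := by
  have := hν.prob
  obtain ⟨K, hK0, hK⟩ := log_outDen_bound hq
  have hm : Measurable fun p : ℝ × ℝ => gauss (p.2 - p.1) :=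
    gauss_cont.measurable.comp (by fun_prop)
  have hm2 : Measurable fun p : ℝ × ℝ => outDen ν p.2 := (outDen_meas ν).comp measurable_snd
  refine key_int h (fun p => Real.log (gauss (p.2 - p.1) / outDen ν p.2))
    (Real.measurable_log.comp (hm.div hm2)) (K + |Real.log (Real.sqrt (2 * Real.pi))| + 3) ?_
  intro x y
  simp only
  rw [Real.log_div (gauss_pos _).ne' (outDen_pos hq hν y).ne', log_gauss]
  have h1 := abs_le.1 (hK ν hν y)
  have h2 := abs_le.1 (le_refl |Real.log (Real.sqrt (2 * Real.pi))|)
  set L := |Real.log (Real.sqrt (2 * Real.pi))|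
  have hL : 0 ≤ L := abs_nonneg _
  have h3 : 0 ≤ (K + L) * (x ^ 2 + y ^ 2) := by positivity
  rw [abs_le]
  constructor <;> nlinarith [sq_nonneg (x + y), sq_nonneg (x - y), sq_nonneg x, sq_nonneg y]

lemma relEnt_int {q : ℝ} (hq : 0 < q) {μ ν : Measure ℝ} (h : Good q μ) (hν : Good q ν) :
    Integrable (fun x => relEnt x ν) μ := by
  have := h.prob
  exact (F_int hq h hν).integral_prod_left

lemma W_int {q : ℝ} (hq : 0 < q) {μ ν ν' : Measure ℝ} (h : Good q μ) (hν : Good q ν)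
    (hν' : Good q ν') :
    Integrable (fun p : ℝ × ℝ => gauss (p.2 - p.1) *
      (Real.log (outDen ν' p.2) - Real.log (outDen ν p.2))) (μ.prod volume) := by
  have := hν.prob
  have := hν'.prob
  obtain ⟨K, hK0, hK⟩ := log_outDen_bound hq
  refine key_int h (fun p => Real.log (outDen ν' p.2) - Real.log (outDen ν p.2))
    ((Real.measurable_log.comp ((outDen_meas ν').comp measurable_snd)).sub
      (Real.measurable_log.comp ((outDen_meas ν).comp measurable_snd))) (2 * K + 2) ?_
  intro x y
  have h1 := abs_le.1 (hK ν hν y)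
  have h2 := abs_le.1 (hK ν' hν' y)
  have h3 : 0 ≤ K * (x ^ 2 + y ^ 2) := by positivity
  simp only
  rw [abs_le]
  constructor <;> nlinarith [sq_nonneg x, sq_nonneg y]

lemma outDen_int {q : ℝ} {μ : Measure ℝ} (h : Good q μ) : Integrable (outDen μ) := by
  have := h.prob
  have := (key_int h (fun _ => 1) measurable_const 1
    (fun x y => by simp only [abs_one]; nlinarith [sq_nonneg x, sq_nonneg y])).integral_prod_right
  simp only [mul_one] at this
  exact this

lemma outDen_integral {q : ℝ} {μ : Measure ℝ} (h : Good q μ) : ∫ y, outDen μ y = 1 := by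
  have := h.prob
  have h1 := key_int h (fun _ => 1) measurable_const 1
    (fun x y => by simp only [abs_one]; nlinarith [sq_nonneg x, sq_nonneg y])
  simp only [mul_one] at h1
  have h2 := integral_integral_swap (f := fun x y => gauss (y - x)) (μ := μ) (ν := volume) h1
  unfold outDen
  rw [← h2]
  have : ∀ x, ∫ y, gauss (y - x) = 1 := fun x => by
    rw [integral_sub_right_eq_self (fun t => gauss t), gauss_integral]
  simp [this]

/-- difference of cross informations -/
lemma J_sub {q : ℝ} (hq : 0 < q) {μ ν ν' : Measure ℝ} (h : Good q μ) (hν : Good q ν)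
    (hν' : Good q ν') :
    (∫ x, relEnt x ν ∂μ) - ∫ x, relEnt x ν' ∂μ =
      ∫ y, outDen μ y * (Real.log (outDen ν' y) - Real.log (outDen ν y)) := by
  have := h.prob
  have e1 : ∫ x, relEnt x ν ∂μ = ∫ p, gauss (p.2 - p.1) *
      Real.log (gauss (p.2 - p.1) / outDen ν p.2) ∂(μ.prod volume) :=
    (integral_prod _ (F_int hq h hν)).symm
  have e2 : ∫ x, relEnt x ν' ∂μ = ∫ p, gauss (p.2 - p.1) *
      Real.log (gauss (p.2 - p.1) / outDen ν' p.2) ∂(μ.prod volume) :=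
    (integral_prod _ (F_int hq h hν')).symm
  rw [e1, e2, ← integral_sub (F_int hq h hν) (F_int hq h hν')]
  have e3 : ∀ p : ℝ × ℝ, gauss (p.2 - p.1) * Real.log (gauss (p.2 - p.1) / outDen ν p.2) -
      gauss (p.2 - p.1) * Real.log (gauss (p.2 - p.1) / outDen ν' p.2) =
      gauss (p.2 - p.1) * (Real.log (outDen ν' p.2) - Real.log (outDen ν p.2)) := by
    intro p
    rw [Real.log_div (gauss_pos _).ne' (outDen_pos hq hν _).ne',
      Real.log_div (gauss_pos _).ne' (outDen_pos hq hν' _).ne']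
    ring
  simp_rw [e3]
  rw [integral_prod_symm _ (W_int hq h hν hν')]
  simp only [outDen, integral_mul_const]

lemma W1_int {q : ℝ} (hq : 0 < q) {μ ν ν' : Measure ℝ} (h : Good q μ) (hν : Good q ν)
    (hν' : Good q ν') :
    Integrable fun y => outDen μ y * (Real.log (outDen ν' y) - Real.log (outDen ν y)) := by
  have := h.prob
  have := (W_int hq h hν hν').integral_prod_right
  simp only [integral_mul_const] at this; exact this

lemma gibbs {q : ℝ} (hq : 0 < q) {μ ν : Measure ℝ} (h : Good q μ) (hν : Good q ν) :
    mutInfo μ ≤ ∫ x, relEnt x ν ∂μ := by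
  have e := J_sub hq h h hν
  have : ∫ y, outDen μ y * (Real.log (outDen ν y) - Real.log (outDen μ y)) ≤
      ∫ y, (outDen ν y - outDen μ y) := by
    refine integral_mono (W1_int hq h h hν) ((outDen_int hν).sub (outDen_int h)) fun y => ?_
    have p1 := outDen_pos hq h y
    have p2 := outDen_pos hq hν y
    simp only
    rw [← Real.log_div p2.ne' p1.ne']
    calc _ ≤ outDen μ y * (outDen ν y / outDen μ y - 1) :=
          mul_le_mul_of_nonneg_left (Real.log_le_sub_one_of_pos (div_pos p2 p1)) p1.le
      _ = _ := by field_simp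
  rw [integral_sub (outDen_int hν) (outDen_int h), outDen_integral h, outDen_integral hν] at this
  unfold mutInfo
  linarith

/-- mixture -/
noncomputable def mix (t : ℝ) (μ ν : Measure ℝ) : Measure ℝ :=
  ENNReal.ofReal (1 - t) • μ + ENNReal.ofReal t • ν

lemma mix_integral {t : ℝ} (h0 : 0 ≤ t) (h1 : t ≤ 1) {μ ν : Measure ℝ} {f : ℝ → ℝ}
    (hf : Integrable f μ) (hg : Integrable f ν) :
    ∫ x, f x ∂(mix t μ ν) = (1 - t) * ∫ x, f x ∂μ + t * ∫ x, f x ∂ν := by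
  unfold mix
  rw [integral_add_measure (hf.smul_measure ENNReal.ofReal_ne_top)
    (hg.smul_measure ENNReal.ofReal_ne_top), integral_smul_measure, integral_smul_measure,
    ENNReal.toReal_ofReal (by linarith), ENNReal.toReal_ofReal h0]
  simp

lemma mix_good {q t : ℝ} (h0 : 0 ≤ t) (h1 : t ≤ 1) {μ ν : Measure ℝ} (h : Good q μ)
    (hν : Good q ν) : Good q (mix t μ ν) := by
  have := h.prob
  have := hν.prob
  have e : ENNReal.ofReal (1 - t) + ENNReal.ofReal t = 1 := by
    rw [← ENNReal.ofReal_add (by linarith) h0]; simp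
  refine ⟨⟨by simp [mix, e]⟩, ?_, ?_⟩
  · simp only [mix, Measure.coe_add, Measure.coe_smul, Pi.add_apply, Pi.smul_apply, smul_eq_mul]
    calc ENNReal.ofReal q = ENNReal.ofReal (1 - t) * ENNReal.ofReal q +
          ENNReal.ofReal t * ENNReal.ofReal q := by rw [← add_mul, e, one_mul]
      _ ≤ _ := by gcongr; exacts [h.atom, hν.atom]
  · exact (h.sq.smul_measure ENNReal.ofReal_ne_top).add_measure
      (hν.sq.smul_measure ENNReal.ofReal_ne_top)

lemma step_one {q : ℝ} (hq : 0 < q) {μ₀ μ : Measure ℝ} (h : Good q μ₀) (hμ : Good q μ)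
    (hmax : ∀ t : ℝ, 0 < t → t < 1 → mutInfo (mix t μ₀ μ) ≤ mutInfo μ₀) :
    ∫ x, relEnt x μ₀ ∂μ ≤ mutInfo μ₀ := by
  have := h.prob
  have := hμ.prob
  have ev : ∀ᶠ t : ℝ in nhdsWithin 0 (Set.Ioi 0), 0 < t ∧ t < 1 :=
    Ioo_mem_nhdsGT one_pos
  have hb : ∀ᶠ t : ℝ in nhdsWithin 0 (Set.Ioi 0), ∫ x, relEnt x (mix t μ₀ μ) ∂μ ≤ mutInfo μ₀ := by
    filter_upwards [ev] with t ht
    have hg := mix_good ht.1.le ht.2.le h hμ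
    have e := mix_integral ht.1.le ht.2.le (relEnt_int hq h hg) (relEnt_int hq hμ hg)
    have h1 := hmax t ht.1 ht.2
    have h2 := gibbs hq h hg
    have h3 : mutInfo (mix t μ₀ μ) = ∫ x, relEnt x (mix t μ₀ μ) ∂(mix t μ₀ μ) := rfl
    rw [← h3] at e
    have h4 := mul_le_mul_of_nonneg_left h2 (by linarith [ht.2] : 0 ≤ 1 - t)
    have h5 : t * ∫ x, relEnt x (mix t μ₀ μ) ∂μ ≤ t * mutInfo μ₀ := by linarith
    exact le_of_mul_le_mul_left h5 ht.1
  obtain ⟨K, hK0, hK⟩ := log_outDen_bound hq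
  have lim : Tendsto (fun t => ∫ y, outDen μ y *
      (Real.log (outDen μ₀ y) - Real.log (outDen (mix t μ₀ μ) y))) (nhdsWithin 0 (Set.Ioi 0))
      (nhds (∫ y, outDen μ y * (Real.log (outDen μ₀ y) - Real.log (outDen μ₀ y)))) := by
    refine tendsto_integral_filter_of_dominated_convergence
      (fun y => outDen μ y * (2 * K + 2 * y ^ 2)) ?_ ?_ ?_ ?_
    · filter_upwards [ev] with t ht
      exact (W1_int hq hμ (mix_good ht.1.le ht.2.le h hμ) h).aestronglyMeasurable
    · filter_upwards [ev] with t ht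
      refine Eventually.of_forall fun y => ?_
      rw [norm_mul, Real.norm_of_nonneg (outDen_pos hq hμ y).le]
      refine mul_le_mul_of_nonneg_left ?_ (outDen_pos hq hμ y).le
      refine (norm_sub_le _ _).trans ?_
      have a1 := hK _ h y
      have a2 := hK _ (mix_good ht.1.le ht.2.le h hμ) y
      simp only [Real.norm_eq_abs]
      linarith
    · have := (key_int hμ (fun p => 2 * K + 2 * p.2 ^ 2) (by fun_prop) (2 * K + 2)
        (fun x y => by
          have : 0 ≤ K * (x ^ 2 + y ^ 2) := by positivity
          rw [abs_of_nonneg (by positivity)]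
          nlinarith [sq_nonneg x, sq_nonneg y])).integral_prod_right
      simp only [integral_mul_const] at this; exact this
    · refine Eventually.of_forall fun y => ?_
      refine (tendsto_const_nhds.sub ?_).const_mul _
      refine ((Real.continuousAt_log (outDen_pos hq h y).ne').tendsto).comp ?_
      have l1 : Tendsto (fun t : ℝ => (1 - t) * outDen μ₀ y + t * outDen μ y)
          (nhdsWithin 0 (Set.Ioi 0)) (nhds (outDen μ₀ y)) := by
        have c : Continuous fun t : ℝ => (1 - t) * outDen μ₀ y + t * outDen μ y := by fun_prop
        have := (c.tendsto 0).mono_left (nhdsWithin_le_nhds (s := Set.Ioi 0))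
        simpa using this
      refine l1.congr' ?_
      filter_upwards [ev] with t ht
      exact (mix_integral ht.1.le ht.2.le (gauss_shift_int y) (gauss_shift_int y)).symm
  simp only [sub_self, mul_zero, integral_zero] at lim
  have hge : ∀ᶠ t : ℝ in nhdsWithin 0 (Set.Ioi 0), ∫ y, outDen μ y *
      (Real.log (outDen μ₀ y) - Real.log (outDen (mix t μ₀ μ) y)) ≤
      mutInfo μ₀ - ∫ x, relEnt x μ₀ ∂μ := by
    filter_upwards [ev, hb] with t ht hbt
    rw [← J_sub hq hμ (mix_good ht.1.le ht.2.le h hμ) h]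
    linarith
  have := le_of_tendsto lim hge
  linarith

lemma fCost_integral {q γ lam : ℝ} (hq : 0 < q) {μ₀ μ : Measure ℝ} (h : Good q μ₀)
    (hμ : Good q μ) : ∫ x, fCost γ lam x μ₀ ∂μ =
      (∫ x, relEnt x μ₀ ∂μ) - mutInfo μ₀ - lam * ((∫ x, x ^ 2 ∂μ) - γ) := by
  have := hμ.prob
  have i1 := relEnt_int hq hμ h
  unfold fCost
  have i2 : Integrable (fun x => relEnt x μ₀ - mutInfo μ₀) μ := i1.sub (integrable_const _)
  have i3 : Integrable (fun x : ℝ => lam * (x ^ 2 - γ)) μ :=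
    (hμ.sq.sub (integrable_const _)).const_mul _
  rw [integral_sub i2 i3, integral_sub i1 (integrable_const _), integral_const_mul,
    integral_sub hμ.sq (integrable_const _)]
  simp

lemma memLam_iff {q γ : ℝ} (hγ : 0 < γ) (μ : Measure ℝ) :
    memLam γ q μ ↔ Good q μ ∧ ∫ x, x ^ 2 ∂μ ≤ γ := by
  constructor
  · rintro ⟨a, b, c⟩
    have g : Good q μ := ⟨a, b, sq_int_iff μ (c.trans_lt ENNReal.ofReal_lt_top)⟩
    rw [g.lint, ENNReal.ofReal_le_ofReal_iff hγ.le] at c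
    exact ⟨g, c⟩
  · rintro ⟨g, c⟩
    exact ⟨g.prob, g.atom, by rw [g.lint]; exact ENNReal.ofReal_le_ofReal c⟩

lemma dirac_good {q : ℝ} (hq1 : q < 1) : Good q (Measure.dirac 0) := by
  refine ⟨inferInstance, ?_, integrable_dirac (by simp)⟩
  simpa using hq1.le

lemma multiplier {q γ : ℝ} (hq : 0 < q) (hq1 : q < 1) (hγ : 0 < γ) {μ₀ : Measure ℝ}
    (h : Good q μ₀)
    (H : ∀ μ, Good q μ → ∫ x, x ^ 2 ∂μ ≤ γ → ∫ x, relEnt x μ₀ ∂μ ≤ mutInfo μ₀) :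
    ∃ lam : ℝ, 0 ≤ lam ∧ ∀ μ, Good q μ →
      (∫ x, relEnt x μ₀ ∂μ) - mutInfo μ₀ ≤ lam * ((∫ x, x ^ 2 ∂μ) - γ) := by
  set A : Measure ℝ → ℝ := fun μ => (∫ x, relEnt x μ₀ ∂μ) - mutInfo μ₀ with hA
  set B : Measure ℝ → ℝ := fun μ => (∫ x, x ^ 2 ∂μ) - γ with hB
  have cross : ∀ μ ν, Good q μ → Good q ν → B μ < 0 → 0 < B ν → A ν / B ν ≤ A μ / B μ := by
    intro μ ν hμ hν bμ bν
    have hd : 0 < B ν - B μ := by linarith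
    set t := -B μ / (B ν - B μ) with ht
    have t0 : 0 ≤ t := div_nonneg (by linarith) hd.le
    have t1 : t ≤ 1 := by rw [ht, div_le_one hd]; linarith
    have hg := mix_good t0 t1 hμ hν
    have e1 := mix_integral t0 t1 hμ.sq hν.sq
    have e2 := mix_integral t0 t1 (relEnt_int hq hμ h) (relEnt_int hq hν h)
    have tt : t * (B ν - B μ) = -B μ := by rw [ht]; field_simp
    have b0 : ∫ x, x ^ 2 ∂(mix t μ ν) ≤ γ := by
      rw [e1]; simp only [hB] at tt; linarith
    have a0 := H _ hg b0
    rw [e2] at a0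
    have a1 : (1 - t) * A μ + t * A ν ≤ 0 := by simp only [hA]; linarith
    have a2 : B ν * A μ - B μ * A ν ≤ 0 := by
      have := mul_le_mul_of_nonneg_right a1 hd.le
      have e : ((1 - t) * A μ + t * A ν) * (B ν - B μ) =
        (B ν - B μ - t * (B ν - B μ)) * A μ + t * (B ν - B μ) * A ν := by ring
      rw [e, tt] at this
      linarith
    rw [← neg_div_neg_eq (A μ), div_le_div_iff₀ bν (by linarith)]
    linarith
  have hd := dirac_good hq1
  have hBd : B (Measure.dirac 0) < 0 := by simp [hB, hγ]
  set S : Set ℝ := insert 0 {r | ∃ ν, Good q ν ∧ 0 < B ν ∧ r = A ν / B ν} with hS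
  have ub : ∀ μ, Good q μ → B μ < 0 → ∀ r ∈ S, r ≤ A μ / B μ := by
    rintro μ hμ bμ r (rfl | ⟨ν, hν, bν, rfl⟩)
    · refine div_nonneg_of_nonpos ?_ bμ.le
      have := H μ hμ (by simp only [hB] at bμ; linarith)
      simp only [hA]; linarith
    · exact cross μ ν hμ hν bμ bν
  have bdd : BddAbove S := ⟨_, fun r hr => ub _ hd hBd r hr⟩
  refine ⟨sSup S, le_csSup bdd (Or.inl rfl), fun μ hμ => ?_⟩
  change A μ ≤ sSup S * B μ
  rcases lt_trichotomy (B μ) 0 with hb | hb | hb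
  · have := csSup_le (s := S) ⟨0, Or.inl rfl⟩ (ub μ hμ hb)
    rwa [le_div_iff_of_neg hb] at this
  · rw [hb, mul_zero]
    have := H μ hμ (by simp only [hB] at hb; linarith)
    simp only [hA]; linarith
  · rw [← div_le_iff₀ hb]
    exact le_csSup bdd (Or.inr ⟨μ, hμ, hb, rfl⟩)

/-- `μ₀ ∈ Λ(γ,q)` maximizes `I` over `Λ(γ,q)` if and only if there is a Lagrange
multiplier `λ ≥ 0` with `λ·(∫x²dμ₀ − γ) = 0` and `∫ f_λ(x;μ₀) dμ(x) ≤ 0` for every probability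
measure `μ` with `μ({0}) ≥ q` and finite second moment. -/
theorem maximizer_iff_lagrange (q γ : ℝ) (hq0 : 0 < q) (hq1 : q < 1) (hγ : 0 < γ)
    (μ₀ : Measure ℝ) (h₀ : memLam γ q μ₀) :
    (∀ μ : Measure ℝ, memLam γ q μ → mutInfo μ ≤ mutInfo μ₀) ↔
      ∃ lam : ℝ, 0 ≤ lam ∧ lam * ((∫ x, x ^ 2 ∂μ₀) - γ) = 0 ∧
        ∀ μ : Measure ℝ, IsProbabilityMeasure μ → ENNReal.ofReal q ≤ μ {0} →
          (∫⁻ x, ENNReal.ofReal (x ^ 2) ∂μ) < ⊤ →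
          ∫ x, fCost γ lam x μ₀ ∂μ ≤ 0 := by
  rw [memLam_iff hγ] at h₀
  obtain ⟨h, h2⟩ := h₀
  constructor
  · intro hmax
    obtain ⟨lam, l0, hl⟩ := multiplier hq0 hq1 hγ h (fun μ hμ hs => by
      refine step_one hq0 h hμ fun t t0 t1 => hmax _ ?_
      rw [memLam_iff hγ]
      refine ⟨mix_good t0.le t1.le h hμ, ?_⟩
      rw [mix_integral t0.le t1.le h.sq hμ.sq]
      nlinarith)
    refine ⟨lam, l0, le_antisymm (mul_nonpos_of_nonneg_of_nonpos l0 (by linarith)) ?_, ?_⟩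
    · have := hl μ₀ h
      rwa [show (∫ x, relEnt x μ₀ ∂μ₀) = mutInfo μ₀ from rfl, sub_self] at this
    · intro μ p a s
      have hμ : Good q μ := ⟨p, a, sq_int_iff μ s⟩
      rw [fCost_integral hq0 h hμ]
      linarith [hl μ hμ]
  · rintro ⟨lam, l0, -, hl⟩ μ hμ
    have hs := hμ.2.2.trans_lt ENNReal.ofReal_lt_top
    rw [memLam_iff hγ] at hμ
    have := hl μ hμ.1.prob hμ.1.atom hs
    rw [fCost_integral hq0 h hμ.1] at this
    have g := gibbs hq0 hμ.1 h
    have := mul_nonpos_of_nonneg_of_nonpos l0 (by linarith [hμ.2] : (∫ x, x ^ 2 ∂μ) - γ ≤ 0)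
    linarith
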